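/- arXiv:1512.07873 — 9 statements merged into one kernel-verified Lean document; each statement's English description precedes it below -/
import Mathlib

section
/- Let J be a finite nonempty index set and let β_j > 0 and μ_j > 0 for each j ∈ J, and let λ be a real number with 0 < λ < Σ_{j∈J} β_j μ_j. Then there exists a unique vector (ν_j)_{j∈J} such that ν_j ∈ (0, β_j) for every j, λ = Σ_{j∈J} ν_j μ_j, and ν_j μ_j/(β_j − ν_j) = ν_ℓ μ_ℓ/(β_ℓ − ν_ℓ) for all j, ℓ ∈ J. -/
/-- Comparison of two solutions having the same total. -/
theorem equilibrium_aux {J : Type*} [Fintype J] (β μ a b : J → ℝ) (hμ : ∀ j, 0 < μ j)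
    (ha : ∀ j, a j ∈ Set.Ioo 0 (β j)) (hb : ∀ j, b j ∈ Set.Ioo 0 (β j))
    (hs : ∑ j, a j * μ j = ∑ j, b j * μ j)
    (h : ∀ j, a j * μ j / (β j - a j) ≤ b j * μ j / (β j - b j)) : a = b := by
  have hle : ∀ j, a j * μ j ≤ b j * μ j := by
    intro j
    obtain ⟨a0, a1⟩ := ha j
    obtain ⟨b0, b1⟩ := hb j
    have hj := h j
    rw [div_le_div_iff₀ (by linarith) (by linarith)] at hj
    have hβ : 0 < β j := by linarith
    have h2 : (a j * μ j) * β j ≤ (b j * μ j) * β j := by nlinarith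
    exact le_of_mul_le_mul_right h2 hβ
  have := (Finset.sum_eq_sum_iff_of_le (fun j _ => hle j)).1 hs
  funext j
  exact mul_right_cancel₀ (hμ j).ne' (this j (Finset.mem_univ j))

/-- existence and uniqueness of the equilibrium quantities ν
(equation (eq-invar-point1) of the paper). -/
theorem equilibrium_exists_unique {J : Type*} [Fintype J] [Nonempty J]
    (β μ : J → ℝ) (lam : ℝ)
    (hβ : ∀ j, 0 < β j) (hμ : ∀ j, 0 < μ j)
    (hlam0 : 0 < lam) (hload : lam < ∑ j, β j * μ j) :
    ∃! ν : J → ℝ,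
      (∀ j, ν j ∈ Set.Ioo 0 (β j)) ∧
      lam = ∑ j, ν j * μ j ∧
      ∀ j ℓ, ν j * μ j / (β j - ν j) = ν ℓ * μ ℓ / (β ℓ - ν ℓ) := by
  have hD : ∀ s ∈ Set.Icc (0:ℝ) 1, ∀ j, 0 < (1 - s) * μ j + s := by
    rintro s ⟨h0, h1⟩ j
    rcases h0.eq_or_lt with rfl | h0
    · simpa using hμ j
    · have := mul_nonneg (sub_nonneg.2 h1) (hμ j).le
      linarith
  have hc : ContinuousOn (fun s : ℝ => ∑ j, s * β j / ((1 - s) * μ j + s) * μ j)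
      (Set.Icc 0 1) := by
    refine continuousOn_finset_sum _ fun j _ => ContinuousOn.mul (ContinuousOn.div ?_ ?_ ?_) ?_
    · fun_prop
    · fun_prop
    · exact fun s hs => (hD s hs j).ne'
    · fun_prop
  obtain ⟨s, ⟨s0, s1⟩, hs⟩ := intermediate_value_Ioo (zero_le_one) hc
    (show lam ∈ _ by simpa using ⟨hlam0, hload⟩)
  have hD' := hD s ⟨s0.le, s1.le⟩
  have hsub : ∀ j, β j - s * β j / ((1 - s) * μ j + s)
      = (1 - s) * μ j * β j / ((1 - s) * μ j + s) := by
    intro j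
    have := (hD' j).ne'
    field_simp
    ring
  have h1s : 0 < 1 - s := by linarith
  refine existsUnique_of_exists_of_unique
    ⟨fun j => s * β j / ((1 - s) * μ j + s), ?_, hs.symm, ?_⟩ ?_
  · intro j
    refine ⟨div_pos (mul_pos s0 (hβ j)) (hD' j), ?_⟩
    rw [← sub_pos, hsub]
    exact div_pos (mul_pos (mul_pos h1s (hμ j)) (hβ j)) (hD' j)
  · have key : ∀ j, s * β j / ((1 - s) * μ j + s) * μ j /
        (β j - s * β j / ((1 - s) * μ j + s)) = s / (1 - s) := by
      intro j
      rw [hsub]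
      have h1 := (hD' j).ne'
      have h2 := (hβ j).ne'
      have h3 := (hμ j).ne'
      have h4 := h1s.ne'
      generalize (1 - s) * μ j + s = D at *
      field_simp
    intro j l
    exact (key j).trans (key l).symm
  · rintro a b ⟨ha, hsa, hra⟩ ⟨hb, hsb, hrb⟩
    obtain ⟨i⟩ := ‹Nonempty J›
    rcases le_total (a i * μ i / (β i - a i)) (b i * μ i / (β i - b i)) with h | h
    · exact equilibrium_aux β μ a b hμ ha hb (hsa.symm.trans hsb)
        fun j => by rw [hra j i, hrb j i]; exact h
    · exact (equilibrium_aux β μ b a hμ hb ha (hsb.symm.trans hsa)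
        fun j => by rw [hra j i, hrb j i]; exact h).symm
end

section
/- Let R be a finite nonempty set of routers with R = |R| elements and define ξ*_{r,j} = (β_j − ν_j)/R for every r ∈ R and j ∈ J. Then for every r ∈ R and j ∈ J: (μ_j/R)·(β_j − Σ_{r'∈R} ξ*_{r',j}) = (λ/R) · ξ*_{r,j} / (Σ_{ℓ∈J} ξ*_{r,ℓ}). In particular ξ* is an equilibrium (zero) of the fluid vector field F. -/
/-- the symmetric point ξ*_{r,j} = (β_j − ν_j)/R satisfies the
equilibrium equation of the fluid dynamics at every (r,j); in particular it is
a zero of the fluid vector field F (Lemma 5(iv) of the paper). -/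
theorem equilibrium_point_is_fluid_zero {J R' : Type*}
    [Fintype J] [Nonempty J] [Fintype R'] [Nonempty R']
    (β μ : J → ℝ) (lam : ℝ)
    (hβ : ∀ j, 0 < β j) (hμ : ∀ j, 0 < μ j)
    (hlam0 : 0 < lam) (hload : lam < ∑ j, β j * μ j)
    (ν : J → ℝ)
    (hν : ∀ j, ν j ∈ Set.Ioo 0 (β j))
    (hνsum : lam = ∑ j, ν j * μ j)
    (hνratio : ∀ j ℓ, ν j * μ j / (β j - ν j) = ν ℓ * μ ℓ / (β ℓ - ν ℓ))
    (ξs : R' → J → ℝ)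
    (hξs : ∀ r j, ξs r j = (β j - ν j) / (Fintype.card R' : ℝ))
    (F : (R' → J → ℝ) → R' → J → ℝ)
    (hF : ∀ ξ r j, F ξ r j =
      (μ j / (Fintype.card R' : ℝ)) * (β j - ∑ r', ξ r' j)
        - (lam / (Fintype.card R' : ℝ)) * ξ r j / (∑ ℓ, ξ r ℓ)) :
    (∀ r j, (μ j / (Fintype.card R' : ℝ)) * (β j - ∑ r', ξs r' j)
        = (lam / (Fintype.card R' : ℝ)) * ξs r j / (∑ ℓ, ξs r ℓ)) ∧
    F ξs = 0 := by
  have key : ∀ r j, (μ j / (Fintype.card R' : ℝ)) * (β j - ∑ r', ξs r' j)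
        = (lam / (Fintype.card R' : ℝ)) * ξs r j / (∑ ℓ, ξs r ℓ) := by
    intro r j
    have hR : (Fintype.card R' : ℝ) ≠ 0 := by
      exact_mod_cast Fintype.card_ne_zero
    have hpos : ∀ ℓ, 0 < β ℓ - ν ℓ := fun ℓ => sub_pos.mpr (hν ℓ).2
    have hS : 0 < ∑ ℓ, (β ℓ - ν ℓ) :=
      Finset.sum_pos (fun ℓ _ => hpos ℓ) Finset.univ_nonempty
    have h1 : ∑ r', ξs r' j = β j - ν j := by
      simp only [hξs, Finset.sum_const, Finset.card_univ, nsmul_eq_mul]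
      field_simp
    have h2 : ∑ ℓ, ξs r ℓ = (∑ ℓ, (β ℓ - ν ℓ)) / (Fintype.card R' : ℝ) := by
      simp only [hξs, Finset.sum_div]
    have h3 : lam * (β j - ν j) = ν j * μ j * ∑ ℓ, (β ℓ - ν ℓ) := by
      rw [hνsum, Finset.sum_mul, Finset.mul_sum]
      refine Finset.sum_congr rfl fun ℓ _ => ?_
      have h := hνratio j ℓ
      rw [div_eq_div_iff (hpos j).ne' (hpos ℓ).ne'] at h
      exact h.symm
    rw [h1, h2, hξs]
    generalize (∑ ℓ, (β ℓ - ν ℓ)) = S at *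
    have hS' := hS.ne'
    rw [eq_div_iff (div_ne_zero hS' hR)]
    field_simp
    linear_combination -h3
  refine ⟨key, ?_⟩
  funext r j
  rw [hF, key r j]
  simp
end

section
/- Let R be a finite nonempty set of routers with R = |R| elements. Suppose ξ ∈ ℝ^{R×J} satisfies ξ_{r,j} ≥ 0 for all r, j, Σ_{ℓ∈J} ξ_{r,ℓ} > 0 for every r ∈ R, and the equilibrium equations (μ_j/R)·(β_j − Σ_{r'∈R} ξ_{r',j}) = (λ/R)·ξ_{r,j}/(Σ_{ℓ∈J} ξ_{r,ℓ}) for all r ∈ R, j ∈ J. Then Σ_{r∈R} ξ_{r,j} = β_j − ν_j for every j ∈ J. -/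
/-- any nonnegative zero of the fluid vector field with positive
per-router pull-message mass has per-pool total mass Σ_r ξ_{r,j} = β_j − ν_j. -/
theorem fluid_zero_pool_mass {J R' : Type*}
    [Fintype J] [Nonempty J] [Fintype R'] [Nonempty R']
    (β μ : J → ℝ) (lam : ℝ)
    (hβ : ∀ j, 0 < β j) (hμ : ∀ j, 0 < μ j)
    (hlam0 : 0 < lam) (hload : lam < ∑ j, β j * μ j)
    (ν : J → ℝ)
    (hν : ∀ j, ν j ∈ Set.Ioo 0 (β j))
    (hνsum : lam = ∑ j, ν j * μ j)
    (hνratio : ∀ j ℓ, ν j * μ j / (β j - ν j) = ν ℓ * μ ℓ / (β ℓ - ν ℓ))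
    (ξ : R' → J → ℝ)
    (hξnonneg : ∀ r j, 0 ≤ ξ r j)
    (hξpos : ∀ r, 0 < ∑ ℓ, ξ r ℓ)
    (heq : ∀ r j, (μ j / (Fintype.card R' : ℝ)) * (β j - ∑ r', ξ r' j)
        = (lam / (Fintype.card R' : ℝ)) * ξ r j / (∑ ℓ, ξ r ℓ)) :
    ∀ j, ∑ r, ξ r j = β j - ν j := by
  have hR : (0 : ℝ) < (Fintype.card R' : ℝ) := by exact_mod_cast Fintype.card_pos
  have e1 : ∀ r j, μ j * (β j - ∑ r', ξ r' j) * (∑ ℓ, ξ r ℓ) = lam * ξ r j := by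
    intro r j
    have h := heq r j
    have hs := hξpos r
    rw [eq_div_iff hs.ne'] at h
    have h2 : (μ j * (β j - ∑ r', ξ r' j) * (∑ ℓ, ξ r ℓ)) / (Fintype.card R' : ℝ)
        = (lam * ξ r j) / (Fintype.card R' : ℝ) := by
      calc _ = μ j / (Fintype.card R' : ℝ) * (β j - ∑ r', ξ r' j) * (∑ ℓ, ξ r ℓ) := by ring
        _ = _ := h
        _ = _ := by ring
    exact (div_left_inj' hR.ne').1 h2
  have hsum : ∑ j, μ j * (β j - ∑ r', ξ r' j) = lam := by
    obtain ⟨r⟩ := ‹Nonempty R'›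
    have h : (∑ j, μ j * (β j - ∑ r', ξ r' j)) * (∑ ℓ, ξ r ℓ) = lam * ∑ ℓ, ξ r ℓ := by
      rw [Finset.sum_mul, Finset.mul_sum]
      exact Finset.sum_congr rfl fun j _ => e1 r j
    exact mul_right_cancel₀ (hξpos r).ne' h
  obtain ⟨S, hS, hSe⟩ : ∃ S : ℝ, 0 < S ∧ ∀ j, μ j * (β j - ∑ r', ξ r' j) * S
      = lam * ∑ r, ξ r j := by
    refine ⟨∑ r, ∑ ℓ, ξ r ℓ, Finset.sum_pos (fun r _ => hξpos r) Finset.univ_nonempty, ?_⟩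
    intro j
    rw [Finset.mul_sum, Finset.mul_sum]
    exact Finset.sum_congr rfl fun r _ => e1 r j
  generalize hT : (fun j => ∑ r, ξ r j) = T at *
  have hT' : ∀ j, ∑ r, ξ r j = T j := fun j => by rw [← hT]
  simp only [hT'] at hsum hSe ⊢
  obtain ⟨j0⟩ := id ‹Nonempty J›
  obtain ⟨d, hd⟩ : ∃ d, d = ν j0 * μ j0 / (β j0 - ν j0) := ⟨_, rfl⟩
  obtain ⟨c, hc⟩ : ∃ c, c = lam / S := ⟨_, rfl⟩
  have hc0 : 0 < c := hc ▸ div_pos hlam0 hS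
  have h1 : ∀ j, ν j * μ j = d * (β j - ν j) := by
    intro j
    have := hνratio j j0
    rw [← hd, div_eq_iff (sub_pos.2 (hν j).2).ne'] at this
    exact this
  have h2 : ∀ j, (β j - T j) * μ j = c * T j := by
    intro j
    rw [hc, div_mul_eq_mul_div, eq_div_iff hS.ne', ← hSe j]
    ring
  have h3 : ∀ j, ν j - (β j - T j) = (d - c) * ((β j - ν j) / (μ j + c)) := by
    intro j
    have hp : 0 < μ j + c := add_pos (hμ j) hc0
    rw [← mul_div_assoc, eq_div_iff hp.ne']
    linear_combination h1 j - h2 j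
  have h4 : (d - c) * ∑ j, ((β j - ν j) / (μ j + c)) * μ j = 0 := by
    have : ∑ j, (ν j * μ j - μ j * (β j - T j)) = 0 := by
      rw [Finset.sum_sub_distrib, hsum, ← hνsum, sub_self]
    rw [← this, Finset.mul_sum]
    refine Finset.sum_congr rfl fun j _ => ?_
    linear_combination -(μ j) * h3 j
  have h5 : 0 < ∑ j, ((β j - ν j) / (μ j + c)) * μ j :=
    Finset.sum_pos (fun j _ => mul_pos (div_pos (sub_pos.2 (hν j).2)
      (add_pos (hμ j) hc0)) (hμ j)) Finset.univ_nonempty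
  have h6 : d - c = 0 := (mul_eq_zero.1 h4).resolve_right h5.ne'
  intro j
  have := h3 j
  rw [h6, zero_mul] at this
  linarith
end

section
/- Let R be a finite nonempty set of routers with R = |R| elements. Suppose ξ ∈ ℝ^{R×J} satisfies ξ_{r,j} ≥ 0 and ξ_{r,j} ≤ (β_j − ν_j)/R for all r ∈ R and j ∈ J, Σ_{ℓ∈J} ξ_{r,ℓ} > 0 for every r ∈ R, and the equilibrium equations (μ_j/R)·(β_j − Σ_{r'∈R} ξ_{r',j}) = (λ/R)·ξ_{r,j}/(Σ_{ℓ∈J} ξ_{r,ℓ}) for all r, j. Then ξ_{r,j} = (β_j − ν_j)/R for all r ∈ R and j ∈ J. -/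
/-- the symmetric point ξ*_{r,j} = (β_j − ν_j)/R is the only
equilibrium of the fluid dynamics dominated componentwise by ξ*
(uniqueness underlying Lemma 5(vi) of the paper). -/
theorem fluid_zero_dominated_is_symmetric {J R' : Type*}
    [Fintype J] [Nonempty J] [Fintype R'] [Nonempty R']
    (β μ : J → ℝ) (lam : ℝ)
    (hβ : ∀ j, 0 < β j) (hμ : ∀ j, 0 < μ j)
    (hlam0 : 0 < lam) (hload : lam < ∑ j, β j * μ j)
    (ν : J → ℝ)
    (hν : ∀ j, ν j ∈ Set.Ioo 0 (β j))
    (hνsum : lam = ∑ j, ν j * μ j)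
    (hνratio : ∀ j ℓ, ν j * μ j / (β j - ν j) = ν ℓ * μ ℓ / (β ℓ - ν ℓ))
    (ξ : R' → J → ℝ)
    (hξnonneg : ∀ r j, 0 ≤ ξ r j)
    (hξdom : ∀ r j, ξ r j ≤ (β j - ν j) / (Fintype.card R' : ℝ))
    (hξpos : ∀ r, 0 < ∑ ℓ, ξ r ℓ)
    (heq : ∀ r j, (μ j / (Fintype.card R' : ℝ)) * (β j - ∑ r', ξ r' j)
        = (lam / (Fintype.card R' : ℝ)) * ξ r j / (∑ ℓ, ξ r ℓ)) :
    ∀ r j, ξ r j = (β j - ν j) / (Fintype.card R' : ℝ) := by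
  have hR : (0 : ℝ) < (Fintype.card R' : ℝ) := by exact_mod_cast Fintype.card_pos
  have hconst : ∀ j, ∑ _r : R', (β j - ν j) / (Fintype.card R' : ℝ) = β j - ν j := by
    intro j
    rw [Finset.sum_const, Finset.card_univ, nsmul_eq_mul]
    field_simp
  have hS : ∀ j, ∑ r', ξ r' j ≤ β j - ν j := by
    intro j
    rw [← hconst j]
    exact Finset.sum_le_sum fun r _ => hξdom r j
  obtain ⟨r0⟩ := ‹Nonempty R'›
  have heq' : ∀ j, μ j * (β j - ∑ r', ξ r' j) = lam * ξ r0 j / (∑ ℓ, ξ r0 ℓ) := by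
    intro j
    have h := heq r0 j
    have hp := hξpos r0
    field_simp at h ⊢
    linarith
  have hsum : ∑ j, μ j * (β j - ∑ r', ξ r' j) = lam := by
    rw [Finset.sum_congr rfl fun j _ => heq' j, ← Finset.sum_div, ← Finset.mul_sum]
    exact mul_div_cancel_right₀ _ (hξpos r0).ne'
  have hzero : ∑ j, μ j * (β j - ν j - ∑ r', ξ r' j) = 0 := by
    have h : ∀ j, μ j * (β j - ν j - ∑ r', ξ r' j)
        = μ j * (β j - ∑ r', ξ r' j) - ν j * μ j := fun j => by ring
    rw [Finset.sum_congr rfl fun j _ => h j, Finset.sum_sub_distrib, hsum, ← hνsum, sub_self]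
  have hterm := (Finset.sum_eq_zero_iff_of_nonneg fun j _ =>
    mul_nonneg (hμ j).le (sub_nonneg.2 (hS j))).1 hzero
  intro r j
  have hSj : ∑ r', ξ r' j = ∑ _r : R', (β j - ν j) / (Fintype.card R' : ℝ) := by
    rw [hconst j]
    rcases mul_eq_zero.1 (hterm j (Finset.mem_univ j)) with h | h
    · exact absurd h (hμ j).ne'
    · linarith
  exact (Finset.sum_eq_sum_iff_of_le fun r _ => hξdom r j).1 hSj r (Finset.mem_univ r)
end

section
/- Let R be a finite nonempty set of routers with R = |R| elements, let ξ*_{r,j} = (β_j − ν_j)/R, and let 0 < τ ≤ ∞. Suppose ξ : [0, τ) → ℝ^{R×J} is differentiable, takes values in U, satisfies ξ'(t) = F(ξ(t)) for all t ∈ [0, τ), and ξ(0) = ξ*. Then ξ(t) = ξ* for all t ∈ [0, τ). -/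
/-- the fluid trajectory started at the equilibrium point
ξ*_{r,j} = (β_j − ν_j)/R is stationary on [0, τ) (Lemma 5(iv) of the paper). -/
theorem fluid_trajectory_at_equilibrium_stationary {J R' : Type*}
    [Fintype J] [Nonempty J] [Fintype R'] [Nonempty R']
    (β μ : J → ℝ) (lam : ℝ)
    (hβ : ∀ j, 0 < β j) (hμ : ∀ j, 0 < μ j)
    (hlam0 : 0 < lam) (hload : lam < ∑ j, β j * μ j)
    (ν : J → ℝ)
    (hν : ∀ j, ν j ∈ Set.Ioo 0 (β j))
    (hνsum : lam = ∑ j, ν j * μ j)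
    (hνratio : ∀ j ℓ, ν j * μ j / (β j - ν j) = ν ℓ * μ ℓ / (β ℓ - ν ℓ))
    (ξs : R' → J → ℝ)
    (hξs : ∀ r j, ξs r j = (β j - ν j) / (Fintype.card R' : ℝ))
    (F : (R' → J → ℝ) → R' → J → ℝ)
    (hF : ∀ ξ r j, F ξ r j =
      (μ j / (Fintype.card R' : ℝ)) * (β j - ∑ r', ξ r' j)
        - (lam / (Fintype.card R' : ℝ)) * ξ r j / (∑ ℓ, ξ r ℓ))
    (U : Set (R' → J → ℝ))
    (hU : U = {ξ | ∀ r, 0 < ∑ ℓ, ξ r ℓ})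
    (τ : ENNReal) (hτ : 0 < τ)
    (D : Set ℝ) (hD : D = {t : ℝ | 0 ≤ t ∧ ENNReal.ofReal t < τ})
    (ξ : ℝ → R' → J → ℝ)
    (hmem : ∀ t ∈ D, ξ t ∈ U)
    (hode : ∀ t ∈ D, HasDerivWithinAt ξ (F (ξ t)) D t)
    (h0 : ξ 0 = ξs) :
    ∀ t ∈ D, ξ t = ξs := by
  have hRpos : (0 : ℝ) < (Fintype.card R' : ℝ) := by exact_mod_cast Fintype.card_pos
  have hpos : ∀ j, 0 < β j - ν j := fun j => sub_pos.2 (hν j).2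
  have hS : 0 < ∑ ℓ, (β ℓ - ν ℓ) :=
    Finset.sum_pos (fun j _ => hpos j) Finset.univ_nonempty
  have hsum : ∀ r, ∑ ℓ, ξs r ℓ = (∑ ℓ, (β ℓ - ν ℓ)) / (Fintype.card R' : ℝ) := by
    intro r
    simp only [hξs, Finset.sum_div]
  have hsumpos : ∀ r, 0 < ∑ ℓ, ξs r ℓ := fun r => by
    rw [hsum]; exact div_pos hS hRpos
  -- the equilibrium is a zero of the vector field
  have hzero : F ξs = 0 := by
    funext r j
    have hc : lam = ν j * μ j / (β j - ν j) * ∑ ℓ, (β ℓ - ν ℓ) := by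
      rw [hνsum, Finset.mul_sum]
      refine Finset.sum_congr rfl fun ℓ _ => ?_
      rw [hνratio j ℓ, div_mul_cancel₀ _ (hpos ℓ).ne']
    have hcol : ∑ r', ξs r' j = β j - ν j := by
      simp only [hξs, Finset.sum_const, Finset.card_univ, nsmul_eq_mul]
      field_simp
    rw [hF, hcol, hsum, hξs, hc]
    have h1 := (hpos j).ne'
    have h2 := hS.ne'
    have h3 := hRpos.ne'
    generalize (∑ ℓ, (β ℓ - ν ℓ)) = S at *
    simp only [Pi.zero_apply]
    field_simp
    ring
  -- the vector field is locally Lipschitz at the equilibrium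
  have hsmooth : ContDiffAt ℝ 1 F ξs := by
    rw [contDiffAt_pi]
    intro r
    rw [contDiffAt_pi]
    intro j
    have hE : (fun ξ => F ξ r j) = fun ξ : R' → J → ℝ =>
      (μ j / (Fintype.card R' : ℝ)) * (β j - ∑ r', ξ r' j)
        - (lam / (Fintype.card R' : ℝ)) * ξ r j / (∑ ℓ, ξ r ℓ) := funext fun ξ => hF ξ r j
    rw [hE]
    have hap : ∀ r' j', ContDiffAt ℝ 1 (fun ξ : R' → J → ℝ => ξ r' j') ξs := fun r' j' =>
      contDiffAt_pi.1 (contDiffAt_pi.1 contDiffAt_id r') j'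
    exact (contDiffAt_const.mul (contDiffAt_const.sub (ContDiffAt.sum fun r' _ => hap r' j))).sub
      ((contDiffAt_const.mul (hap r j)).div (ContDiffAt.sum fun ℓ _ => hap r ℓ) (hsumpos r).ne')
  obtain ⟨K, N, hN, hLip⟩ := hsmooth.exists_lipschitzOnWith
  intro T hT
  have hT' := hT
  rw [hD] at hT'
  have hsub : Set.Icc 0 T ⊆ D := by
    intro t ht
    rw [hD]
    exact ⟨ht.1, (ENNReal.ofReal_le_ofReal ht.2).trans_lt hT'.2⟩
  have hcont : ContinuousOn ξ (Set.Icc 0 T) := fun t ht =>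
    ((hode t (hsub ht)).continuousWithinAt).mono hsub
  have hclosed : IsClosed ({t | ξ t = ξs} ∩ Set.Icc 0 T) := by
    have := hcont.preimage_isClosed_of_isClosed isClosed_Icc (isClosed_singleton (x := ξs))
    rw [Set.inter_comm]
    exact this
  refine hclosed.Icc_subset_of_forall_mem_nhdsWithin h0 ?_ ⟨hT'.1, le_rfl⟩
  rintro x ⟨hx, hx0, hxT⟩
  have hx : ξ x = ξs := hx
  have hev : ∀ᶠ t in nhdsWithin x (Set.Ici x), t ∈ Set.Icc 0 T ∧ ξ t ∈ N := by
    have h1 : Set.Icc 0 T ∈ nhdsWithin x (Set.Ici x) :=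
      Filter.mem_of_superset (Icc_mem_nhdsGE hxT) (Set.Icc_subset_Icc_left hx0)
    have h2 := (hcont x ⟨hx0, hxT.le⟩).mono_of_mem_nhdsWithin h1
    exact Filter.Eventually.and h1 (h2 (by rw [hx]; exact hN))
  obtain ⟨b, hb, hbs⟩ := mem_nhdsGE_iff_exists_Icc_subset.1 hev
  have hb : x < b := hb
  have key : Set.EqOn ξ (fun _ => ξs) (Set.Icc x b) := by
    refine ODE_solution_unique_of_mem_Icc_right (v := fun _ => F) (s := fun _ => N) (K := K)
      (fun _ _ => hLip) (hcont.mono fun t ht => (hbs ht).1) ?_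
      (fun t ht => (hbs (Set.Ico_subset_Icc_self ht)).2) continuousOn_const ?_
      (fun _ _ => mem_of_mem_nhds hN) hx
    · intro t ht
      refine (hode t (hsub (hbs (Set.Ico_subset_Icc_self ht)).1)).mono_of_mem_nhdsWithin ?_
      refine Filter.mem_of_superset (Icc_mem_nhdsGE ht.2) fun s hs => ?_
      exact hsub (hbs ⟨ht.1.trans hs.1, hs.2⟩).1
    · intro t _
      simp only [hzero]
      exact hasDerivWithinAt_const _ _ _
  exact Filter.mem_of_superset (Ioc_mem_nhdsGT hb) fun t ht => key ⟨ht.1.le, ht.2⟩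
end

section
/- Let R be a finite nonempty set of routers with R = |R| elements. Suppose ξ, ξ̄ : [0, ∞) → ℝ^{R×J} are differentiable, take values in U, satisfy ξ'(t) = F(ξ(t)) and ξ̄'(t) = F(ξ̄(t)) for all t ≥ 0, and ξ̄_{r,j}(t) ≥ ξ_{r,j}(t) for all t ≥ 0, r ∈ R, j ∈ J. Then the function h(t) = Σ_{r∈R} Σ_{j∈J} (ξ̄_{r,j}(t) − ξ_{r,j}(t)) satisfies h'(t) = − Σ_{j∈J} μ_j Σ_{r∈R} (ξ̄_{r,j}(t) − ξ_{r,j}(t)) ≤ 0 for all t > 0; in particular h is non-increasing and h(t) ≤ h(0) for all t ≥ 0. -/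
/-- contraction estimate from the uniqueness proof of Lemma 5(vi):
the ℓ¹ distance h(t) = Σ_{r,j}(ξ̄_{r,j}(t) − ξ_{r,j}(t)) between two ordered
fluid trajectories has derivative h'(t) = −Σ_j μ_j Σ_r (ξ̄ − ξ) ≤ 0, so h is
non-increasing. -/
theorem fluid_ordered_trajectories_contraction {J R' : Type*}
    [Fintype J] [Nonempty J] [Fintype R'] [Nonempty R']
    (β μ : J → ℝ) (lam : ℝ)
    (hβ : ∀ j, 0 < β j) (hμ : ∀ j, 0 < μ j)
    (hlam0 : 0 < lam) (hload : lam < ∑ j, β j * μ j)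
    (F : (R' → J → ℝ) → R' → J → ℝ)
    (hF : ∀ ξ r j, F ξ r j =
      (μ j / (Fintype.card R' : ℝ)) * (β j - ∑ r', ξ r' j)
        - (lam / (Fintype.card R' : ℝ)) * ξ r j / (∑ ℓ, ξ r ℓ))
    (U : Set (R' → J → ℝ))
    (hU : U = {ξ | ∀ r, 0 < ∑ ℓ, ξ r ℓ})
    (ξ ξb : ℝ → R' → J → ℝ)
    (hmem : ∀ t : ℝ, 0 ≤ t → ξ t ∈ U)
    (hmemb : ∀ t : ℝ, 0 ≤ t → ξb t ∈ U)
    (hode : ∀ t : ℝ, 0 ≤ t → HasDerivWithinAt ξ (F (ξ t)) (Set.Ici 0) t)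
    (hodeb : ∀ t : ℝ, 0 ≤ t → HasDerivWithinAt ξb (F (ξb t)) (Set.Ici 0) t)
    (hdom : ∀ t : ℝ, 0 ≤ t → ∀ r j, ξ t r j ≤ ξb t r j) :
    (∀ t : ℝ, 0 < t →
      HasDerivAt (fun u => ∑ r, ∑ j, (ξb u r j - ξ u r j))
        (-(∑ j, μ j * ∑ r, (ξb t r j - ξ t r j))) t ∧
      -(∑ j, μ j * ∑ r, (ξb t r j - ξ t r j)) ≤ 0) ∧
    AntitoneOn (fun t => ∑ r, ∑ j, (ξb t r j - ξ t r j)) (Set.Ici 0) ∧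
    ∀ t : ℝ, 0 ≤ t →
      (∑ r, ∑ j, (ξb t r j - ξ t r j)) ≤ ∑ r, ∑ j, (ξb 0 r j - ξ 0 r j) := by
  have hR : (Fintype.card R' : ℝ) ≠ 0 := by
    exact_mod_cast Fintype.card_ne_zero
  have key : ∀ x ∈ U, ∑ r, ∑ j, F x r j = ∑ j, μ j * (β j - ∑ r, x r j) - lam := by
    intro x hx
    rw [hU] at hx
    have h1 : ∀ r, ∑ j, F x r j =
        (∑ j, μ j * (β j - ∑ r, x r j)) / (Fintype.card R' : ℝ)
          - lam / (Fintype.card R' : ℝ) := by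
      intro r
      have hs : (∑ ℓ, x r ℓ) ≠ 0 := (hx r).ne'
      simp only [hF, Finset.sum_sub_distrib]
      congr 1
      · rw [Finset.sum_div]
        exact Finset.sum_congr rfl fun j _ => by ring
      · rw [← Finset.sum_div, ← Finset.mul_sum, mul_div_assoc, div_self hs, mul_one]
    simp only [h1, Finset.sum_const, Finset.card_univ, nsmul_eq_mul]
    field_simp
  have hd : ∀ t : ℝ, 0 ≤ t →
      HasDerivWithinAt (fun u => ∑ r, ∑ j, (ξb u r j - ξ u r j))
        (-(∑ j, μ j * ∑ r, (ξb t r j - ξ t r j))) (Set.Ici 0) t := by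
    intro t ht
    have h2 : HasDerivWithinAt (fun u => ∑ r, ∑ j, (ξb u r j - ξ u r j))
        (∑ r, ∑ j, (F (ξb t) r j - F (ξ t) r j)) (Set.Ici 0) t := by
      refine HasDerivWithinAt.fun_sum fun r _ => HasDerivWithinAt.fun_sum fun j _ => ?_
      exact (hasDerivWithinAt_pi.1 (hasDerivWithinAt_pi.1 (hodeb t ht) r) j).fun_sub
        (hasDerivWithinAt_pi.1 (hasDerivWithinAt_pi.1 (hode t ht) r) j)
    convert h2 using 1
    simp only [Finset.sum_sub_distrib, key _ (hmem t ht), key _ (hmemb t ht), mul_sub]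
    ring
  have hneg : ∀ t : ℝ, 0 ≤ t → -(∑ j, μ j * ∑ r, (ξb t r j - ξ t r j)) ≤ 0 := by
    intro t ht
    rw [neg_nonpos]
    exact Finset.sum_nonneg fun j _ => mul_nonneg (hμ j).le
      (Finset.sum_nonneg fun r _ => sub_nonneg.2 (hdom t ht r j))
  have hanti : AntitoneOn (fun t => ∑ r, ∑ j, (ξb t r j - ξ t r j)) (Set.Ici 0) := by
    refine antitoneOn_of_hasDerivWithinAt_nonpos (convex_Ici 0)
      (fun t ht => (hd t ht).continuousWithinAt)
      (fun t ht => (hd t (interior_subset ht)).mono interior_subset)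
      (fun t ht => hneg t (interior_subset ht))
  exact ⟨fun t ht => ⟨(hd t ht.le).hasDerivAt (Ici_mem_nhds ht), hneg t ht.le⟩, hanti,
    fun t ht => hanti (Set.mem_Ici.2 le_rfl) ht ht⟩
end

section
/- Let R be a finite nonempty set of routers with R = |R| elements and ξ*_{r,j} = (β_j − ν_j)/R. Suppose ξ : [0, ∞) → ℝ^{R×J} is differentiable, satisfies ξ'(t) = F(ξ(t)) for all t ≥ 0, and for all t ≥ 0, r ∈ R, j ∈ J: 0 ≤ ξ_{r,j}(t) ≤ (β_j − ν_j)/R, Σ_{ℓ∈J} ξ_{r,ℓ}(t) > 0, and each map t ↦ ξ_{r,j}(t) is non-decreasing. Then ξ_{r,j}(t) → (β_j − ν_j)/R as t → ∞, for every r ∈ R and j ∈ J. -/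
/-- convergence part of Lemma 5(vi): a componentwise
non-decreasing fluid trajectory dominated by the equilibrium point ξ*
converges to ξ*_{r,j} = (β_j − ν_j)/R as t → ∞. -/
theorem fluid_monotone_trajectory_converges {J R' : Type*}
    [Fintype J] [Nonempty J] [Fintype R'] [Nonempty R']
    (β μ : J → ℝ) (lam : ℝ)
    (hβ : ∀ j, 0 < β j) (hμ : ∀ j, 0 < μ j)
    (hlam0 : 0 < lam) (hload : lam < ∑ j, β j * μ j)
    (ν : J → ℝ)
    (hν : ∀ j, ν j ∈ Set.Ioo 0 (β j))
    (hνsum : lam = ∑ j, ν j * μ j)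
    (hνratio : ∀ j ℓ, ν j * μ j / (β j - ν j) = ν ℓ * μ ℓ / (β ℓ - ν ℓ))
    (F : (R' → J → ℝ) → R' → J → ℝ)
    (hF : ∀ ξ r j, F ξ r j =
      (μ j / (Fintype.card R' : ℝ)) * (β j - ∑ r', ξ r' j)
        - (lam / (Fintype.card R' : ℝ)) * ξ r j / (∑ ℓ, ξ r ℓ))
    (ξ : ℝ → R' → J → ℝ)
    (hode : ∀ t : ℝ, 0 ≤ t → HasDerivWithinAt ξ (F (ξ t)) (Set.Ici 0) t)
    (hnonneg : ∀ t : ℝ, 0 ≤ t → ∀ r j, 0 ≤ ξ t r j)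
    (hdom : ∀ t : ℝ, 0 ≤ t → ∀ r j,
      ξ t r j ≤ (β j - ν j) / (Fintype.card R' : ℝ))
    (hpos : ∀ t : ℝ, 0 ≤ t → ∀ r, 0 < ∑ ℓ, ξ t r ℓ)
    (hmono : ∀ r j, MonotoneOn (fun t => ξ t r j) (Set.Ici 0)) :
    ∀ r j, Filter.Tendsto (fun t => ξ t r j) Filter.atTop
      (nhds ((β j - ν j) / (Fintype.card R' : ℝ))) := by
  have hN : (0 : ℝ) < (Fintype.card R' : ℝ) := by exact_mod_cast Fintype.card_pos
  intro r j
  -- the derivative of the row sum of router r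
  have hcomp : ∀ t : ℝ, 0 ≤ t → ∀ ℓ, HasDerivWithinAt (fun s => ξ s r ℓ) (F (ξ t) r ℓ)
      (Set.Ici 0) t := by
    intro t ht ℓ
    exact (hasDerivWithinAt_pi.1 ((hasDerivWithinAt_pi.1 (hode t ht)) r)) ℓ
  have hV : ∀ t : ℝ, 0 ≤ t → HasDerivWithinAt (fun s => ∑ ℓ, ξ s r ℓ) (∑ ℓ, F (ξ t) r ℓ)
      (Set.Ici 0) t := by
    intro t ht
    exact HasDerivWithinAt.fun_sum (fun ℓ _ => hcomp t ht ℓ)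
  have hsum : ∀ t : ℝ, 0 ≤ t → ∑ ℓ, F (ξ t) r ℓ =
      ∑ ℓ, (μ ℓ / (Fintype.card R' : ℝ)) *
        ∑ r', ((β ℓ - ν ℓ) / (Fintype.card R' : ℝ) - ξ t r' ℓ) := by
    intro t ht
    have h1 : ∑ ℓ, (lam / (Fintype.card R' : ℝ)) * ξ t r ℓ / (∑ ℓ', ξ t r ℓ')
        = ∑ ℓ, (μ ℓ / (Fintype.card R' : ℝ)) * ν ℓ := by
      rw [← Finset.sum_div, ← Finset.mul_sum, mul_div_assoc, div_self (hpos t ht r).ne', mul_one,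
        hνsum, Finset.sum_div]
      exact Finset.sum_congr rfl (fun ℓ _ => by ring)
    simp only [hF]
    rw [Finset.sum_sub_distrib, h1, ← Finset.sum_sub_distrib]
    refine Finset.sum_congr rfl (fun ℓ _ => ?_)
    rw [Finset.sum_sub_distrib, Finset.sum_const, Finset.card_univ, nsmul_eq_mul,
      mul_div_cancel₀ _ hN.ne']
    ring
  have hlow : ∀ t : ℝ, 0 ≤ t → (μ j / (Fintype.card R' : ℝ)) *
      ((β j - ν j) / (Fintype.card R' : ℝ) - ξ t r j) ≤ ∑ ℓ, F (ξ t) r ℓ := by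
    intro t ht
    have hd : ∀ r' ℓ, 0 ≤ (β ℓ - ν ℓ) / (Fintype.card R' : ℝ) - ξ t r' ℓ :=
      fun r' ℓ => sub_nonneg.2 (hdom t ht r' ℓ)
    rw [hsum t ht]
    calc _ ≤ (μ j / (Fintype.card R' : ℝ)) *
          ∑ r', ((β j - ν j) / (Fintype.card R' : ℝ) - ξ t r' j) := by
          refine mul_le_mul_of_nonneg_left ?_ (div_pos (hμ j) hN).le
          exact Finset.single_le_sum
            (f := fun r' => (β j - ν j) / (Fintype.card R' : ℝ) - ξ t r' j)
            (fun r' _ => hd r' j) (Finset.mem_univ r)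
      _ ≤ _ := by
          exact Finset.single_le_sum
            (f := fun ℓ => (μ ℓ / (Fintype.card R' : ℝ)) *
              ∑ r', ((β ℓ - ν ℓ) / (Fintype.card R' : ℝ) - ξ t r' ℓ))
            (fun ℓ _ => mul_nonneg (div_pos (hμ ℓ) hN).le
              (Finset.sum_nonneg fun r' _ => hd r' ℓ)) (Finset.mem_univ j)
  rw [Metric.tendsto_atTop]
  intro ε hε
  have key : ∃ t : ℝ, 0 ≤ t ∧ (β j - ν j) / (Fintype.card R' : ℝ) - ξ t r j < ε := by
    by_contra! hcon
    set c : ℝ := μ j / (Fintype.card R' : ℝ) * ε with hc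
    have hc0 : 0 < c := mul_pos (div_pos (hμ j) hN) hε
    set B : ℝ := ∑ ℓ, (β ℓ - ν ℓ) / (Fintype.card R' : ℝ) with hB
    have hB0 : 0 ≤ B := Finset.sum_nonneg fun ℓ _ =>
      div_nonneg (sub_nonneg.2 (hν ℓ).2.le) hN.le
    have hDA : ∀ t ∈ interior (Set.Ici (0 : ℝ)),
        HasDerivAt (fun s => ∑ ℓ, ξ s r ℓ) (∑ ℓ, F (ξ t) r ℓ) t := by
      intro t ht
      rw [interior_Ici] at ht
      exact (hV t (le_of_lt ht)).hasDerivAt (Ici_mem_nhds ht)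
    have hT : (0 : ℝ) ≤ B / c := div_nonneg hB0 hc0.le
    have hgrow := (convex_Ici (0 : ℝ)).mul_sub_le_image_sub_of_le_deriv
      (f := fun s => ∑ ℓ, ξ s r ℓ)
      (fun t ht => (hV t ht).continuousWithinAt)
      (fun t ht => (hDA t ht).differentiableAt.differentiableWithinAt)
      (C := c)
      (by
        intro t ht
        rw [(hDA t ht).deriv]
        have ht0 : 0 ≤ t := interior_subset ht
        exact (mul_le_mul_of_nonneg_left (hcon t ht0) (div_pos (hμ j) hN).le).trans (hlow t ht0))
      0 (Set.mem_Ici.2 le_rfl) (B / c) hT hT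
    have hup : ∑ ℓ, ξ (B / c) r ℓ ≤ B := Finset.sum_le_sum fun ℓ _ => hdom _ hT r ℓ
    have h0 := hpos 0 le_rfl r
    rw [sub_zero, mul_div_cancel₀ _ hc0.ne'] at hgrow
    linarith
  obtain ⟨T, hT0, hT⟩ := key
  refine ⟨T, fun t ht => ?_⟩
  have ht0 : 0 ≤ t := hT0.trans ht
  have hm : ξ T r j ≤ ξ t r j := hmono r j hT0 ht0 ht
  have hd := hdom t ht0 r j
  rw [Real.dist_eq, abs_lt]
  constructor <;> linarith
end

section
/- Let ε > 0, δ > 0, c > 0, and let g : (0, ε] → ℝ be differentiable and bounded above. Suppose that for every u ∈ (0, ε], g(u) ≥ δ implies g'(u) ≤ −c/u. Then g(u) ≤ δ for every u ∈ (0, ε]. -/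
/-- real-analysis lemma (eq-claim-delta) from Step 2 of Lemma 5(v):
an upper-bounded differentiable function g on (0, ε] whose derivative is at most
−c/u whenever g(u) ≥ δ can never exceed δ. -/
theorem bounded_above_forced_decay (ε δ c : ℝ) (hε : 0 < ε) (hδ : 0 < δ)
    (hc : 0 < c) (g g' : ℝ → ℝ)
    (hderiv : ∀ u ∈ Set.Ioc 0 ε, HasDerivWithinAt g (g' u) (Set.Ioc 0 ε) u)
    (hbdd : BddAbove (g '' Set.Ioc 0 ε))
    (himp : ∀ u ∈ Set.Ioc 0 ε, δ ≤ g u → g' u ≤ -c / u) :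
    ∀ u ∈ Set.Ioc 0 ε, g u ≤ δ := by
  intro u hu
  by_contra hgu
  push Not at hgu
  have hcont : ∀ v, 0 < v → ContinuousOn g (Set.Icc v u) := by
    intro v hv x hx
    have hsub : Set.Icc v u ⊆ Set.Ioc 0 ε :=
      fun y hy => ⟨lt_of_lt_of_le hv hy.1, hy.2.trans hu.2⟩
    exact ((hderiv x (hsub hx)).continuousWithinAt).mono hsub
  have key : ∀ v, 0 < v → v < u → (∀ x ∈ Set.Ioo v u, δ ≤ g x) →
      g u + c * Real.log u ≤ g v + c * Real.log v := by
    intro v hv hvu hx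
    obtain ⟨x, hxm, hxe⟩ := exists_hasDerivAt_eq_slope
      (fun y => g y + c * Real.log y) (fun y => g' y + c * y⁻¹) hvu
      ((hcont v hv).add (continuousOn_const.mul (Real.continuousOn_log.mono
        (fun y hy => (lt_of_lt_of_le hv hy.1).ne'))))
      (fun y hy => by
        have hy0 : 0 < y := hv.trans hy.1
        have hye : y < ε := lt_of_lt_of_le hy.2 hu.2
        exact ((hderiv y ⟨hy0, hye.le⟩).hasDerivAt (Ioc_mem_nhds hy0 hye)).add
          ((Real.hasDerivAt_log hy0.ne').const_mul c))
    have h1 := himp x ⟨hv.trans hxm.1, hxm.2.le.trans hu.2⟩ (hx x hxm)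
    have h2 : g' x + c * x⁻¹ ≤ 0 := by
      have : -c / x = -(c * x⁻¹) := by ring
      linarith
    rw [eq_div_iff (by linarith)] at hxe
    have h3 : (g' x + c * x⁻¹) * (u - v) ≤ 0 :=
      mul_nonpos_of_nonpos_of_nonneg h2 (by linarith)
    linarith
  have big : ∀ v, 0 < v → v ≤ u → δ < g v := by
    intro v hv hvu
    by_contra hgv
    push Not at hgv
    have hcomp : IsCompact (Set.Icc v u ∩ g ⁻¹' Set.Iic δ) :=
      isCompact_Icc.of_isClosed_subset
        ((hcont v hv).preimage_isClosed_of_isClosed isClosed_Icc isClosed_Iic)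
        Set.inter_subset_left
    obtain ⟨s, ⟨hs, hgs⟩, hmax⟩ := hcomp.exists_isGreatest ⟨v, ⟨le_refl v, hvu⟩, hgv⟩
    have hgs' : g s ≤ δ := hgs
    have hs0 : 0 < s := lt_of_lt_of_le hv hs.1
    have hsu : s < u := lt_of_le_of_ne hs.2 (by rintro rfl; linarith)
    have h1 := key s hs0 hsu (fun x hx => by
      by_contra hlt
      push Not at hlt
      have := hmax ⟨⟨hs.1.trans hx.1.le, hx.2.le⟩, hlt.le⟩
      linarith [hx.1])
    have h2 := mul_le_mul_of_nonneg_left (Real.log_le_log hs0 hsu.le) hc.le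
    linarith
  obtain ⟨M, hM⟩ := hbdd
  have hMu : g u ≤ M := hM ⟨u, hu, rfl⟩
  -- the point where the logarithmic lower bound exceeds `M`
  set t : ℝ := (M - g u + 1) / c with ht
  have htpos : 0 < t := div_pos (by linarith) hc
  have hct : c * t = M - g u + 1 := by rw [ht]; field_simp
  have hv0 : 0 < u * Real.exp (-t) := mul_pos hu.1 (Real.exp_pos _)
  have hvu : u * Real.exp (-t) < u :=
    mul_lt_of_lt_one_right hu.1 (Real.exp_lt_one_iff.mpr (by linarith))
  have h1 := key _ hv0 hvu (fun x hx => (big x (hv0.trans hx.1) hx.2.le).le)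
  rw [Real.log_mul hu.1.ne' (Real.exp_pos _).ne', Real.log_exp] at h1
  have h2 := hM ⟨_, ⟨hv0, hvu.le.trans hu.2⟩, rfl⟩
  linarith
end

section
/- Let J be a finite nonempty index set, let R ≥ 1 be an integer, let λ > 0 and ε > 0. Let w_j : [0, ε] → ℝ be continuous with w_j(0) > 0 for every j ∈ J and Σ_{j∈J} w_j(0) > λ. Let ξ_j : [0, ε] → ℝ (j ∈ J) be Lipschitz continuous functions with ξ_j(0) = 0, ξ_j(u) > 0 for u ∈ (0, ε], differentiable on (0, ε] with ξ_j'(u) = w_j(u)/R − (λ/R)·ξ_j(u)/(Σ_{ℓ∈J} ξ_ℓ(u)) for all u ∈ (0, ε], and satisfying lim_{u→0+} (Σ_{j∈J} ξ_j(u))/u = (Σ_{j∈J} w_j(0) − λ)/R. Then for every j ∈ J: lim_{u→0+} ξ_j(u)/u = (w_j(0)/R) · (Σ_{ℓ∈J} w_ℓ(0) − λ)/(Σ_{ℓ∈J} w_ℓ(0)). -/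
/-- Step 2 of the proof of Lemma 5(v) (equation (eq-y0j)):
identification of the right derivative of the pull-message mass ξ_j at 0. -/
theorem pull_mass_right_derivative {J : Type*} [Fintype J] [Nonempty J]
    (R : ℕ) (hR : 1 ≤ R) (lam ε : ℝ) (hlam : 0 < lam) (hε : 0 < ε)
    (w : J → ℝ → ℝ)
    (hwcont : ∀ j, ContinuousOn (w j) (Set.Icc 0 ε))
    (hw0 : ∀ j, 0 < w j 0)
    (hwsum : lam < ∑ j, w j 0)
    (ξ : J → ℝ → ℝ)
    (hlip : ∀ j, ∃ K : NNReal, LipschitzOnWith K (ξ j) (Set.Icc 0 ε))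
    (hξ0 : ∀ j, ξ j 0 = 0)
    (hpos : ∀ j, ∀ u ∈ Set.Ioc 0 ε, 0 < ξ j u)
    (hode : ∀ j, ∀ u ∈ Set.Ioc 0 ε,
      HasDerivWithinAt (ξ j)
        (w j u / (R : ℝ) - (lam / (R : ℝ)) * (ξ j u / (∑ ℓ, ξ ℓ u)))
        (Set.Ioc 0 ε) u)
    (hlim : Filter.Tendsto (fun u => (∑ j, ξ j u) / u)
      (nhdsWithin 0 (Set.Ioi 0)) (nhds (((∑ j, w j 0) - lam) / (R : ℝ)))) :
    ∀ j, Filter.Tendsto (fun u => ξ j u / u) (nhdsWithin 0 (Set.Ioi 0))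
      (nhds ((w j 0 / (R : ℝ)) *
        (((∑ ℓ, w ℓ 0) - lam) / (∑ ℓ, w ℓ 0)))) := by
  intro j
  have hR0 : (0 : ℝ) < R := by exact_mod_cast hR
  obtain ⟨K, hK⟩ := hlip j
  set W : ℝ := ∑ ℓ, w ℓ 0 with hW
  have hWpos : 0 < W := hlam.trans hwsum
  have hWl : 0 < W - lam := sub_pos.2 hwsum
  set k : ℝ := lam / (W - lam) with hk
  have hkpos : 0 < k := div_pos hlam hWl
  have hS : ∀ u ∈ Set.Ioc 0 ε, 0 < ∑ ℓ, ξ ℓ u := fun u hu =>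
    Finset.sum_pos (fun ℓ _ => hpos ℓ u hu) Finset.univ_nonempty
  have hmem : ∀ᶠ u in nhdsWithin (0 : ℝ) (Set.Ioi 0), u ∈ Set.Ioo 0 ε :=
    Ioo_mem_nhdsGT hε
  have hbd : ∀ u ∈ Set.Ioo 0 ε, |ξ j u / u| ≤ K := by
    intro u hu
    have h := hK.dist_le_mul u ⟨hu.1.le, hu.2.le⟩ 0 ⟨le_rfl, hε.le⟩
    rw [Real.dist_eq, Real.dist_eq, hξ0, sub_zero, sub_zero] at h
    rw [abs_div, div_le_iff₀ (abs_pos.2 hu.1.ne')]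
    exact h
  have hu0 : Filter.Tendsto (fun u : ℝ => u) (nhdsWithin (0 : ℝ) (Set.Ioi 0)) (nhds 0) :=
    Filter.tendsto_id.mono_left nhdsWithin_le_nhds
  have hw : Filter.Tendsto (w j) (nhdsWithin (0 : ℝ) (Set.Ioi 0)) (nhds (w j 0)) := by
    have h := hwcont j 0 ⟨le_rfl, hε.le⟩
    refine h.tendsto.mono_left ?_
    rw [← nhdsWithin_Ioo_eq_nhdsGT hε]
    exact nhdsWithin_mono _ Set.Ioo_subset_Icc_self
  have hx0 : Filter.Tendsto (ξ j) (nhdsWithin (0 : ℝ) (Set.Ioi 0)) (nhds 0) := by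
    have h := hK.continuousOn 0 ⟨le_rfl, hε.le⟩
    have h2 := h.tendsto
    rw [hξ0] at h2
    refine h2.mono_left ?_
    rw [← nhdsWithin_Ioo_eq_nhdsGT hε]
    exact nhdsWithin_mono _ Set.Ioo_subset_Icc_self
  have hpow : ∀ p : ℝ, 0 < p →
      Filter.Tendsto (fun u : ℝ => u ^ p) (nhdsWithin (0 : ℝ) (Set.Ioi 0)) (nhds 0) := by
    intro p hp
    have h := hu0.rpow_const (p := p) (Or.inr hp.le)
    rwa [Real.zero_rpow hp.ne'] at h
  have herr : Filter.Tendsto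
      (fun u => (k - lam / R * ((∑ ℓ, ξ ℓ u) / u)⁻¹) * (ξ j u / u))
      (nhdsWithin (0 : ℝ) (Set.Ioi 0)) (nhds 0) := by
    have h1 : Filter.Tendsto (fun u => k - lam / R * ((∑ ℓ, ξ ℓ u) / u)⁻¹)
        (nhdsWithin (0 : ℝ) (Set.Ioi 0)) (nhds 0) := by
      have h := ((hlim.inv₀ (div_pos hWl hR0).ne').const_mul (lam / R)).const_sub k
      have e : k - lam / R * ((W - lam) / R)⁻¹ = 0 := by
        rw [hk]; field_simp; ring
      rwa [e] at h
    refine h1.zero_mul_isBoundedUnder_le ?_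
    refine Filter.isBoundedUnder_of_eventually_le (a := (K : ℝ)) ?_
    filter_upwards [hmem] with u hu
    exact hbd u hu
  have hquot : Filter.Tendsto (fun u => (u ^ k * ξ j u) / u ^ (k + 1))
      (nhdsWithin (0 : ℝ) (Set.Ioi 0))
      (nhds ((w j 0 / R) * ((W - lam) / W))) := by
    refine HasDerivAt.lhopital_zero_right_on_Ioo hε
      (f' := fun u => (k * u ^ (k - 1)) * ξ j u +
        u ^ k * (w j u / (R : ℝ) - (lam / (R : ℝ)) * (ξ j u / (∑ ℓ, ξ ℓ u))))
      (g' := fun u => (k + 1) * u ^ (k + 1 - 1)) ?_ ?_ ?_ ?_ ?_ ?_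
    · intro u hu
      have h1 := Real.hasDerivAt_rpow_const (x := u) (p := k) (Or.inl hu.1.ne')
      have h2 := (hode j u ⟨hu.1, hu.2.le⟩).hasDerivAt (Ioc_mem_nhds hu.1 hu.2)
      exact h1.mul h2
    · intro u hu
      exact Real.hasDerivAt_rpow_const (Or.inl hu.1.ne')
    · intro u hu
      have := Real.rpow_pos_of_pos hu.1 (k + 1 - 1)
      positivity
    · simpa using (hpow k hkpos).mul hx0
    · exact hpow (k + 1) (by positivity)
    · have h := ((hw.div_const (R : ℝ)).add herr).div_const (k + 1)
      have e : (w j 0 / R + 0) / (k + 1) = (w j 0 / R) * ((W - lam) / W) := by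
        have : k + 1 = W / (W - lam) := by rw [hk]; field_simp; ring
        rw [this, add_zero, div_div_eq_mul_div, mul_div_assoc]
      rw [e] at h
      refine h.congr' ?_
      filter_upwards [hmem] with u hu
      have hup := hu.1
      have hp := Real.rpow_pos_of_pos hup k
      have hSu := hS u ⟨hu.1, hu.2.le⟩
      rw [add_sub_cancel_right, Real.rpow_sub_one hup.ne']
      generalize u ^ k = P at *
      generalize (∑ ℓ, ξ ℓ u) = S at *
      have : k + 1 ≠ 0 := by positivity
      clear_value k
      field_simp
      ring
  refine hquot.congr' ?_
  filter_upwards [hmem] with u hu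
  have hp := Real.rpow_pos_of_pos hu.1 k
  rw [Real.rpow_add_one hu.1.ne', mul_div_mul_left _ _ hp.ne']
end
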